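/- Let 𝓔 and 𝓖 be nonempty (non-degenerate, i.e., containing some nonempty structure) Fraïssé classes of finite structures in disjoint relational signatures, each with the disjoint amalgamation property; let U_𝓔, U_𝓖 denote their Fraïssé limits and U the Fraïssé limit of the mixed sum 𝓔 ⋈ 𝓖. Then L^U (with the 𝓔-signature structure) is isomorphic to U_𝓔, R^U (with the 𝓖-signature structure) is isomorphic to U_𝓖, and the bipartite graph ⟨U, L^U, R^U, ∼^U⟩ is the universal homogeneous bipartite graph, i.e., it satisfies condition (⋆). -/

import Mathlib

open FirstOrder CategoryTheory FirstOrder.Language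

/-- The language of the mixed sum of two relational languages `L1`, `L2`: their (disjoint)
union together with two unary predicates `L` (coded by `true`) and `R` (coded by `false`)
and a binary relation `∼`. -/
def mixLang (L1 L2 : FirstOrder.Language.{0, 0}) : FirstOrder.Language where
  Functions _ := Empty
  Relations n := (L1.Relations n ⊕ L2.Relations n) ⊕
    (match n with
      | 1 => Bool
      | 2 => Unit
      | _ => Empty)

instance (L1 L2 : FirstOrder.Language.{0, 0}) (n : ℕ) :
    IsEmpty ((mixLang L1 L2).Functions n) :=
  inferInstanceAs (IsEmpty Empty)

variable (L1 L2 : FirstOrder.Language.{0, 0})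

/-- The left-side predicate `L`. -/
def mixL {M : Type} [(mixLang L1 L2).Structure M] (x : M) : Prop :=
  Structure.RelMap (L := mixLang L1 L2) (n := 1) (Sum.inr true) ![x]

/-- The right-side predicate `R`. -/
def mixR {M : Type} [(mixLang L1 L2).Structure M] (x : M) : Prop :=
  Structure.RelMap (L := mixLang L1 L2) (n := 1) (Sum.inr false) ![x]

/-- The bipartite edge relation `∼`. -/
def mixAdj {M : Type} [(mixLang L1 L2).Structure M] (x y : M) : Prop :=
  Structure.RelMap (L := mixLang L1 L2) (n := 2) (Sum.inr ()) ![x, y]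

/-- The `L1`-structure induced on the left side `L^M`. -/
def mixLeftStruct [L1.IsRelational] (M : Type) [(mixLang L1 L2).Structure M] :
    L1.Structure {x : M // mixL L1 L2 x} where
  funMap f _ := isEmptyElim f
  RelMap {n} R v := Structure.RelMap (L := mixLang L1 L2) (n := n) (Sum.inl (Sum.inl R))
    (fun i => ((v i : {x : M // mixL L1 L2 x}) : M))

/-- The `L2`-structure induced on the right side `R^M`. -/
def mixRightStruct [L2.IsRelational] (M : Type) [(mixLang L1 L2).Structure M] :
    L2.Structure {x : M // mixR L1 L2 x} where
  funMap f _ := isEmptyElim f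
  RelMap {n} R v := Structure.RelMap (L := mixLang L1 L2) (n := n) (Sum.inl (Sum.inr R))
    (fun i => ((v i : {x : M // mixR L1 L2 x}) : M))

/-- `M` is a mixed sum of a member of `E1` and a member of `E2`: `{L^M, R^M}` partitions
`M`, the `L1`-relations hold only among elements of `L^M` (which forms a structure in `E1`),
the `L2`-relations hold only among elements of `R^M` (which forms a structure in `E2`), and
`∼` is a bipartite graph relation between `L^M` and `R^M`. -/
def MixMem [L1.IsRelational] [L2.IsRelational]
    (E1 : Set (Bundled.{0} L1.Structure)) (E2 : Set (Bundled.{0} L2.Structure))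
    (M : Type) [(mixLang L1 L2).Structure M] : Prop :=
  (∀ x : M, (mixL L1 L2 x ∨ mixR L1 L2 x) ∧ ¬(mixL L1 L2 x ∧ mixR L1 L2 x)) ∧
  (∀ {n : ℕ} (R : L1.Relations n) (v : Fin n → M),
    Structure.RelMap (L := mixLang L1 L2) (Sum.inl (Sum.inl R)) v → ∀ i, mixL L1 L2 (v i)) ∧
  (∀ {n : ℕ} (R : L2.Relations n) (v : Fin n → M),
    Structure.RelMap (L := mixLang L1 L2) (Sum.inl (Sum.inr R)) v → ∀ i, mixR L1 L2 (v i)) ∧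
  (∀ x y : M, mixAdj L1 L2 x y → mixAdj L1 L2 y x) ∧
  (∀ x y : M, mixAdj L1 L2 x y →
    (mixL L1 L2 x ∧ mixR L1 L2 y) ∨ (mixR L1 L2 x ∧ mixL L1 L2 y)) ∧
  (⟨{x : M // mixL L1 L2 x}, mixLeftStruct L1 L2 M⟩ : Bundled.{0} L1.Structure) ∈ E1 ∧
  (⟨{x : M // mixR L1 L2 x}, mixRightStruct L1 L2 M⟩ : Bundled.{0} L2.Structure) ∈ E2

/-- The mixed sum `E1 ⋈ E2` of two classes of finite structures. -/
def mixClass [L1.IsRelational] [L2.IsRelational]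
    (E1 : Set (Bundled.{0} L1.Structure)) (E2 : Set (Bundled.{0} L2.Structure)) :
    Set (Bundled.{0} (mixLang L1 L2).Structure) :=
  {M | Finite M ∧ MixMem L1 L2 E1 E2 M}

/-- Disjoint (strong) amalgamation for a class of structures. -/
def DisjointAmalgamation {L : FirstOrder.Language.{0, 0}} (K : Set (Bundled.{0} L.Structure)) : Prop :=
  ∀ (M N P : Bundled.{0} L.Structure) (MN : M ↪[L] N) (MP : M ↪[L] P),
    M ∈ K → N ∈ K → P ∈ K →
      ∃ (Q : Bundled.{0} L.Structure) (NQ : N ↪[L] Q) (PQ : P ↪[L] Q),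
        Q ∈ K ∧ NQ.comp MN = PQ.comp MP ∧
        ∀ (n : N) (p : P), NQ n = PQ p → ∃ m : M, n = MN m ∧ p = MP m

/-- Condition `(⋆)` for the bipartite graph underlying a mixed sum. -/
def MixStar (U : Type) [(mixLang L1 L2).Structure U] : Prop :=
  ∀ A B : Finset U, Disjoint A B →
    ∃ ℓ r : U, mixL L1 L2 ℓ ∧ mixR L1 L2 r ∧
      ℓ ∉ A ∧ ℓ ∉ B ∧ r ∉ A ∧ r ∉ B ∧
      (∀ y ∈ A, mixR L1 L2 y → mixAdj L1 L2 ℓ y) ∧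
      (∀ y ∈ B, mixR L1 L2 y → ¬ mixAdj L1 L2 ℓ y) ∧
      (∀ x ∈ A, mixL L1 L2 x → mixAdj L1 L2 x r) ∧
      (∀ x ∈ B, mixL L1 L2 x → ¬ mixAdj L1 L2 x r)

namespace FirstOrder.Language

/-- If every relation of `L'` restricted to the tuples in `P` either is (the trace of) a relation
of `L` or is constant, and `P` is invariant under automorphisms, then `P` inherits
ultrahomogeneity. -/
theorem IsUltrahomogeneous.subtype {L L' : FirstOrder.Language.{0, 0}}
    [L.IsRelational] [L'.IsRelational] {U : Type} [L'.Structure U]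
    (hU : L'.IsUltrahomogeneous U) (P : U → Prop) [L.Structure {x // P x}]
    (φ : ∀ {n : ℕ}, L.Relations n → L'.Relations n)
    (hφ : ∀ {n : ℕ} (r : L.Relations n) (v : Fin n → {x // P x}),
      Structure.RelMap r v ↔ Structure.RelMap (φ r) (fun i => (v i : U)))
    (hP : ∀ (g : U ≃[L'] U) (x : U), P (g x) ↔ P x)
    (hconst : ∀ {n : ℕ} (r : L'.Relations n), (∃ r', φ r' = r) ∨
      ∀ v w : Fin n → {x // P x},
        Structure.RelMap r (fun i => (v i : U)) ↔ Structure.RelMap r (fun i => (w i : U))) :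
    L.IsUltrahomogeneous {x // P x} := by
  intro S hS f
  have hfin : Finite S := hS.finite
  let T : L'.Substructure U := Substructure.closure L' (Subtype.val '' (S : Set {x // P x}))
  have hT : ∀ x : U, x ∈ T ↔ ∃ h : P x, (⟨x, h⟩ : {x // P x}) ∈ S := by
    intro x
    exact (Substructure.mem_closure_iff_of_isRelational L' _ _).trans (by simp)
  have hTfg : T.FG := Substructure.fg_closure ((Set.toFinite (S : Set {x // P x})).image _)
  let c : T → S := fun x => ⟨⟨x, ((hT x).1 x.2).1⟩, ((hT x).1 x.2).2⟩
  let F : T ↪[L'] U :=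
    { toFun := fun x => (f (c x) : {x // P x})
      inj' := by
        intro x y hxy
        exact Subtype.ext (congrArg (fun z : S => (z : {x // P x}).1)
          (f.injective (Subtype.ext hxy)))
      map_fun' := fun r => isEmptyElim r
      map_rel' := by
        intro n r v
        rcases hconst r with ⟨r', rfl⟩ | hr
        · have h1 := f.map_rel r' (c ∘ v)
          have h2 : Structure.RelMap r' (c ∘ v) ↔
            Structure.RelMap r' (fun i => ((c (v i) : S) : {x // P x})) := Iff.rfl
          rw [h2, hφ, hφ] at h1
          exact h1
        · exact hr (fun i => f (c (v i))) (fun i => c (v i)) }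
  obtain ⟨g, hg⟩ := hU T hTfg F
  have hgs : ∀ x : {x // P x}, P (g x) := fun x => (hP g x).2 x.2
  have hgs' : ∀ x : {x // P x}, P (g.symm x) := fun x => by
    rw [← hP g, g.apply_symm_apply]; exact x.2
  refine ⟨⟨⟨fun x => ⟨g x, hgs x⟩, fun x => ⟨g.symm x, hgs' x⟩, fun x => by simp,
    fun x => by simp⟩, fun r => isEmptyElim r, fun {n} r v => ?_⟩, ?_⟩
  · rw [hφ, hφ]
    exact g.map_rel (φ r) (fun i => (v i : U))
  · ext x
    have hx : (x : U) ∈ T := (hT x).2 ⟨x.1.2, x.2⟩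
    exact DFunLike.congr_fun hg (⟨x, hx⟩ : T)

end FirstOrder.Language

theorem DisjointAmalgamation.exists_fresh {L : FirstOrder.Language.{0, 0}} [L.IsRelational]
    {K : Set (Bundled.{0} L.Structure)} (hK : IsFraisse K) (hd : DisjointAmalgamation K)
    (hne : ∃ M ∈ K, Nonempty M) (S : Bundled.{0} L.Structure) (hS : S ∈ K) :
    ∃ (Q : Bundled.{0} L.Structure) (i : S ↪[L] Q), Q ∈ K ∧ ∃ q : Q, ∀ s, i s ≠ q := by
  obtain ⟨M, hM, ⟨m⟩⟩ := hne
  obtain ⟨J, hJ, ⟨e⟩, ⟨e'⟩⟩ := hK.jointEmbedding S hS M hM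
  let Z : L.Substructure S := ⊥
  have hZ : (⟨Z, inferInstance⟩ : Bundled.{0} L.Structure) ∈ K :=
    hK.hereditary S hS (age.fg_substructure Substructure.fg_bot)
  obtain ⟨Q, a, b, hQ, -, h⟩ := hd _ S J Z.subtype (e.comp Z.subtype) hZ hS hJ
  refine ⟨Q, a, hQ, b (e' m), fun s hs => ?_⟩
  obtain ⟨z, -⟩ := h s (e' m) hs
  have hz : (z : S) ∈ Substructure.closure L (∅ : Set S) := by
    rw [Substructure.closure_empty]; exact z.2
  exact (Substructure.mem_closure_iff_of_isRelational L _ _).1 hz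

attribute [local instance] mixLeftStruct mixRightStruct

theorem mem_closure_mixLang {L1 L2 : FirstOrder.Language.{0, 0}} {U : Type}
    [(mixLang L1 L2).Structure U] {X : Set U} {x : U} (h : x ∈ X) :
    x ∈ Substructure.closure (mixLang L1 L2) X :=
  Substructure.subset_closure h

section Embedding

variable {M N : Type} [(mixLang L1 L2).Structure M] [(mixLang L1 L2).Structure N]

theorem mixL_map_iff (f : M ↪[mixLang L1 L2] N) (x : M) :
    mixL L1 L2 (f x) ↔ mixL L1 L2 x := by
  have h := f.map_rel (n := 1) (Sum.inr true) ![x]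
  rwa [show f ∘ ![x] = ![f x] by ext i; fin_cases i; rfl] at h

theorem mixR_map_iff (f : M ↪[mixLang L1 L2] N) (x : M) :
    mixR L1 L2 (f x) ↔ mixR L1 L2 x := by
  have h := f.map_rel (n := 1) (Sum.inr false) ![x]
  rwa [show f ∘ ![x] = ![f x] by ext i; fin_cases i; rfl] at h

theorem mixAdj_map_iff (f : M ↪[mixLang L1 L2] N) (x y : M) :
    mixAdj L1 L2 (f x) (f y) ↔ mixAdj L1 L2 x y := by
  have h := f.map_rel (n := 2) (Sum.inr ()) ![x, y]
  rwa [show f ∘ ![x, y] = ![f x, f y] by ext i; fin_cases i <;> rfl] at h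

/-- An embedding of mixed structures restricts to the left sides. -/
def mixLeftMap [L1.IsRelational] (f : M ↪[mixLang L1 L2] N) :
    {x : M // mixL L1 L2 x} ↪[L1] {x : N // mixL L1 L2 x} where
  toFun x := ⟨f x, (mixL_map_iff L1 L2 f x).2 x.2⟩
  inj' _ _ h := Subtype.ext (f.injective (congrArg Subtype.val h))
  map_fun' r := isEmptyElim r
  map_rel' r v := f.map_rel (Sum.inl (Sum.inl r)) (fun i => (v i : M))

/-- An embedding of mixed structures restricts to the right sides. -/
def mixRightMap [L2.IsRelational] (f : M ↪[mixLang L1 L2] N) :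
    {x : M // mixR L1 L2 x} ↪[L2] {x : N // mixR L1 L2 x} where
  toFun x := ⟨f x, (mixR_map_iff L1 L2 f x).2 x.2⟩
  inj' _ _ h := Subtype.ext (f.injective (congrArg Subtype.val h))
  map_fun' r := isEmptyElim r
  map_rel' r v := f.map_rel (Sum.inl (Sum.inr r)) (fun i => (v i : M))

end Embedding

/-- The carrier of the mixed sum of `A` and `B` with edges given by `E`. -/
def MixSum {A B : Type} (_ : A → B → Prop) : Type := A ⊕ B

section MixSum

variable {A B : Type} [L1.Structure A] [L2.Structure B] (E : A → B → Prop)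

/-- The interpretation of the side predicates and of the edge relation in a mixed sum. -/
def mixSumRel : (n : ℕ) → (match n with
      | 1 => Bool
      | 2 => Unit
      | _ => Empty) → (Fin n → MixSum E) → Prop
  | 1, true, v => ∃ a, v 0 = Sum.inl a
  | 1, false, v => ∃ b, v 0 = Sum.inr b
  | 2, _, v => ∃ a b, E a b ∧
      (v 0 = Sum.inl a ∧ v 1 = Sum.inr b ∨ v 0 = Sum.inr b ∧ v 1 = Sum.inl a)

instance mixSumStruct : (mixLang L1 L2).Structure (MixSum E) where
  funMap f _ := isEmptyElim f
  RelMap {n} r v := Sum.elim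
    (Sum.elim (fun r => ∃ w : Fin n → A, v = Sum.inl ∘ w ∧ Structure.RelMap r w)
      (fun r => ∃ w : Fin n → B, v = Sum.inr ∘ w ∧ Structure.RelMap r w))
    (fun r => mixSumRel E n r v) r

theorem mixSum_mixL_iff (x : MixSum E) : mixL L1 L2 x ↔ ∃ a, x = Sum.inl a := Iff.rfl

theorem mixSum_mixR_iff (x : MixSum E) : mixR L1 L2 x ↔ ∃ b, x = Sum.inr b := Iff.rfl

theorem mixSum_mixAdj_iff (x y : MixSum E) : mixAdj L1 L2 x y ↔
    ∃ a b, E a b ∧ (x = Sum.inl a ∧ y = Sum.inr b ∨ x = Sum.inr b ∧ y = Sum.inl a) := Iff.rfl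

theorem mixSum_relMap_left_iff {n : ℕ} (r : L1.Relations n) (v : Fin n → MixSum E) :
    Structure.RelMap (L := mixLang L1 L2) (Sum.inl (Sum.inl r)) v ↔
      ∃ w : Fin n → A, v = Sum.inl ∘ w ∧ Structure.RelMap r w := by
  rfl

theorem mixSum_relMap_right_iff {n : ℕ} (r : L2.Relations n) (v : Fin n → MixSum E) :
    Structure.RelMap (L := mixLang L1 L2) (Sum.inl (Sum.inr r)) v ↔
      ∃ w : Fin n → B, v = Sum.inr ∘ w ∧ Structure.RelMap r w := by
  rfl

theorem mixSum_left_equiv [L1.IsRelational] :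
    Nonempty (A ≃[L1] {x : MixSum E // mixL L1 L2 x}) := by
  refine ⟨⟨Equiv.ofBijective (fun a => ⟨Sum.inl a, a, rfl⟩) ⟨?_, ?_⟩,
    fun r => isEmptyElim r, fun {n} r v => ?_⟩⟩
  · intro a a' h
    exact Sum.inl_injective (congrArg Subtype.val h)
  · rintro ⟨x, a, hx⟩
    exact ⟨a, Subtype.ext hx.symm⟩
  · refine (mixSum_relMap_left_iff L1 L2 E r (fun i => Sum.inl (v i))).trans ?_
    constructor
    · rintro ⟨w, hw, h⟩
      rwa [show v = w from funext fun i => Sum.inl_injective (congrFun hw i)]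
    · exact fun h => ⟨v, rfl, h⟩

theorem mixSum_right_equiv [L2.IsRelational] :
    Nonempty (B ≃[L2] {x : MixSum E // mixR L1 L2 x}) := by
  refine ⟨⟨Equiv.ofBijective (fun b => ⟨Sum.inr b, b, rfl⟩) ⟨?_, ?_⟩,
    fun r => isEmptyElim r, fun {n} r v => ?_⟩⟩
  · intro a a' h
    exact Sum.inr_injective (congrArg Subtype.val h)
  · rintro ⟨x, a, hx⟩
    exact ⟨a, Subtype.ext hx.symm⟩
  · refine (mixSum_relMap_right_iff L1 L2 E r (fun i => Sum.inr (v i))).trans ?_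
    constructor
    · rintro ⟨w, hw, h⟩
      rwa [show v = w from funext fun i => Sum.inr_injective (congrFun hw i)]
    · exact fun h => ⟨v, rfl, h⟩

end MixSum

section MixClass

variable {L1 L2} [L1.IsRelational] [L2.IsRelational]
  {E1 : Set (Bundled.{0} L1.Structure)} {E2 : Set (Bundled.{0} L2.Structure)}

theorem mixSum_mem_mixClass (hE1 : IsFraisse E1) (hE2 : IsFraisse E2)
    {A : Bundled.{0} L1.Structure} {B : Bundled.{0} L2.Structure} [Finite A] [Finite B]
    (hA : A ∈ E1) (hB : B ∈ E2) (E : A → B → Prop) :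
    (⟨MixSum E, mixSumStruct L1 L2 E⟩ : Bundled.{0} (mixLang L1 L2).Structure) ∈
      mixClass L1 L2 E1 E2 := by
  refine ⟨inferInstanceAs (Finite (A ⊕ B)), ?_, ?_, ?_, ?_, ?_, ?_, ?_⟩
  · rintro (a | b)
    · exact ⟨Or.inl ⟨a, rfl⟩, fun ⟨_, b, hb⟩ => Sum.inl_ne_inr hb⟩
    · exact ⟨Or.inr ⟨b, rfl⟩, fun ⟨⟨a, ha⟩, _⟩ => Sum.inr_ne_inl ha⟩
  · rintro n r v ⟨w, rfl, -⟩ i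
    exact ⟨w i, rfl⟩
  · rintro n r v ⟨w, rfl, -⟩ i
    exact ⟨w i, rfl⟩
  · rintro x y ⟨a, b, h, h'⟩
    exact ⟨a, b, h, h'.symm.imp And.symm And.symm⟩
  · rintro x y ⟨a, b, -, ⟨hx, hy⟩ | ⟨hx, hy⟩⟩
    · exact Or.inl ⟨⟨a, hx⟩, ⟨b, hy⟩⟩
    · exact Or.inr ⟨⟨b, hx⟩, ⟨a, hy⟩⟩
  · exact (hE1.is_equiv_invariant (mixSum_left_equiv L1 L2 E)).1 hA
  · exact (hE2.is_equiv_invariant (mixSum_right_equiv L1 L2 E)).1 hB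

/-- Embeddings of the two sides of a mixed structure `S` that respect the edges glue to an
embedding of `S` into a mixed sum. -/
theorem MixMem.exists_embedding_mixSum {S : Type} [(mixLang L1 L2).Structure S]
    (hS : MixMem L1 L2 E1 E2 S) {A B : Type} [L1.Structure A] [L2.Structure B]
    (i : {x : S // mixL L1 L2 x} ↪[L1] A) (j : {x : S // mixR L1 L2 x} ↪[L2] B)
    (E : A → B → Prop) (hE : ∀ x y, E (i x) (j y) ↔ mixAdj L1 L2 (x : S) (y : S)) :
    ∃ f : S ↪[mixLang L1 L2] MixSum E,
      (∀ x : {x : S // mixL L1 L2 x}, f x = Sum.inl (i x)) ∧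
      ∀ y : {y : S // mixR L1 L2 y}, f y = Sum.inr (j y) := by
  classical
  obtain ⟨hpart, hrel1, hrel2, hsymm, hbip, -, -⟩ := hS
  have hR : ∀ {x : S}, ¬ mixL L1 L2 x → mixR L1 L2 x := fun {x} h => (hpart x).1.resolve_left h
  let f : S → MixSum E := fun x =>
    if h : mixL L1 L2 x then Sum.inl (i ⟨x, h⟩) else Sum.inr (j ⟨x, hR h⟩)
  have hfl : ∀ x : {x : S // mixL L1 L2 x}, f x = Sum.inl (i x) := fun x => dif_pos x.2
  have hfr : ∀ y : {y : S // mixR L1 L2 y}, f y = Sum.inr (j y) := fun y =>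
    dif_neg fun h => (hpart y).2 ⟨h, y.2⟩
  have hcases : ∀ x : S, (∃ x' : {x : S // mixL L1 L2 x}, x = x') ∨
      ∃ x' : {x : S // mixR L1 L2 x}, x = x' := fun x =>
    (hpart x).1.imp (fun h => ⟨⟨x, h⟩, rfl⟩) (fun h => ⟨⟨x, h⟩, rfl⟩)
  have hinl : ∀ {x a}, f x = Sum.inl a → ∃ x' : {x : S // mixL L1 L2 x}, x = x' ∧ i x' = a := by
    intro x a h
    obtain ⟨x, rfl⟩ | ⟨x, rfl⟩ := hcases x
    · exact ⟨x, rfl, Sum.inl_injective ((hfl x).symm.trans h)⟩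
    · exact absurd ((hfr x).symm.trans h) Sum.inr_ne_inl
  have hinr : ∀ {x b}, f x = Sum.inr b → ∃ x' : {x : S // mixR L1 L2 x}, x = x' ∧ j x' = b := by
    intro x a h
    obtain ⟨x, rfl⟩ | ⟨x, rfl⟩ := hcases x
    · exact absurd ((hfl x).symm.trans h) Sum.inl_ne_inr
    · exact ⟨x, rfl, Sum.inr_injective ((hfr x).symm.trans h)⟩
  refine ⟨⟨⟨f, ?_⟩, fun r => isEmptyElim r, ?_⟩, hfl, hfr⟩
  · intro x y h
    obtain ⟨x, rfl⟩ | ⟨x, rfl⟩ := hcases x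
    · obtain ⟨y, rfl, hy⟩ := hinl (h.symm.trans (hfl x))
      rw [i.injective hy]
    · obtain ⟨y, rfl, hy⟩ := hinr (h.symm.trans (hfr x))
      rw [j.injective hy]
  · rintro n ((r | r) | r) v
    · refine (mixSum_relMap_left_iff L1 L2 E r (f ∘ v)).trans ⟨?_, fun h => ?_⟩
      · rintro ⟨w, hw, h⟩
        choose v' hv' hw' using fun k => hinl (congrFun hw k)
        obtain rfl : v = fun k => (v' k : S) := funext hv'
        obtain rfl : i ∘ v' = w := funext hw'
        exact (i.map_rel r v').1 h
      · have hv := hrel1 r v h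
        refine ⟨fun k => i ⟨v k, hv k⟩, funext fun k => hfl ⟨v k, hv k⟩, ?_⟩
        exact (i.map_rel r fun k => ⟨v k, hv k⟩).2 h
    · refine (mixSum_relMap_right_iff L1 L2 E r (f ∘ v)).trans ⟨?_, fun h => ?_⟩
      · rintro ⟨w, hw, h⟩
        choose v' hv' hw' using fun k => hinr (congrFun hw k)
        obtain rfl : v = fun k => (v' k : S) := funext hv'
        obtain rfl : j ∘ v' = w := funext hw'
        exact (j.map_rel r v').1 h
      · have hv := hrel2 r v h
        refine ⟨fun k => j ⟨v k, hv k⟩, funext fun k => hfr ⟨v k, hv k⟩, ?_⟩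
        exact (j.map_rel r fun k => ⟨v k, hv k⟩).2 h
    · match n, r, v with
      | 1, true, v =>
        have hv : v = ![v 0] := by ext k; fin_cases k; rfl
        rw [hv]
        refine Iff.trans (b := ∃ a, f (v 0) = Sum.inl a) Iff.rfl ⟨?_, fun h => ⟨_, hfl ⟨_, h⟩⟩⟩
        rintro ⟨a, ha⟩
        obtain ⟨x, hx, -⟩ := hinl ha
        exact hx ▸ x.2
      | 1, false, v =>
        have hv : v = ![v 0] := by ext k; fin_cases k; rfl
        rw [hv]
        refine Iff.trans (b := ∃ a, f (v 0) = Sum.inr a) Iff.rfl ⟨?_, fun h => ⟨_, hfr ⟨_, h⟩⟩⟩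
        rintro ⟨a, ha⟩
        obtain ⟨x, hx, -⟩ := hinr ha
        exact hx ▸ x.2
      | 2, (), v =>
        have hv : v = ![v 0, v 1] := by ext k; fin_cases k <;> rfl
        rw [hv]
        refine Iff.trans (mixSum_mixAdj_iff L1 L2 E (f (v 0)) (f (v 1)))
          (Iff.trans ?_ (Iff.rfl (a := mixAdj L1 L2 (v 0) (v 1))))
        constructor
        · rintro ⟨a, b, h, ⟨ha, hb⟩ | ⟨hb, ha⟩⟩
          all_goals
            obtain ⟨x, hx, rfl⟩ := hinl ha
            obtain ⟨y, hy, rfl⟩ := hinr hb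
            rw [hx, hy]
          · exact (hE x y).1 h
          · exact hsymm _ _ ((hE x y).1 h)
        · intro h
          obtain ⟨hx, hy⟩ | ⟨hy, hx⟩ := hbip _ _ h
          · exact ⟨_, _, (hE ⟨_, hx⟩ ⟨_, hy⟩).2 h, Or.inl ⟨hfl ⟨_, hx⟩, hfr ⟨_, hy⟩⟩⟩
          · exact ⟨_, _, (hE ⟨_, hx⟩ ⟨_, hy⟩).2 (hsymm _ _ h), Or.inr ⟨hfr ⟨_, hy⟩, hfl ⟨_, hx⟩⟩⟩

variable {U : Type} [(mixLang L1 L2).Structure U] [Countable U]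

theorem mixMem_closure (hU : IsFraisseLimit (mixClass L1 L2 E1 E2) U) {X : Set U}
    (hX : X.Finite) : MixMem L1 L2 E1 E2 (Substructure.closure (mixLang L1 L2) X) := by
  have h := age.fg_substructure (Substructure.fg_closure (L := mixLang L1 L2) hX)
  rw [hU.age] at h
  exact h.2

theorem mixL_or_mixR (hU : IsFraisseLimit (mixClass L1 L2 E1 E2) U) (x : U) :
    (mixL L1 L2 x ∨ mixR L1 L2 x) ∧ ¬(mixL L1 L2 x ∧ mixR L1 L2 x) := by
  have h := (mixMem_closure hU (Set.finite_singleton x)).1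
    ⟨x, mem_closure_mixLang rfl⟩
  rwa [← mixL_map_iff L1 L2 (Substructure.subtype _), ← mixR_map_iff L1 L2 (Substructure.subtype _)]
    at h

theorem mixL_of_relMap (hU : IsFraisseLimit (mixClass L1 L2 E1 E2) U) {n : ℕ}
    (r : L1.Relations n) (v : Fin n → U)
    (h : Structure.RelMap (L := mixLang L1 L2) (Sum.inl (Sum.inl r)) v) (i : Fin n) :
    mixL L1 L2 (v i) := by
  have := (mixMem_closure hU (Set.finite_range v)).2.1 r
    (fun k => ⟨v k, mem_closure_mixLang ⟨k, rfl⟩⟩) h i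
  rwa [← mixL_map_iff L1 L2 (Substructure.subtype _)] at this

theorem mixR_of_relMap (hU : IsFraisseLimit (mixClass L1 L2 E1 E2) U) {n : ℕ}
    (r : L2.Relations n) (v : Fin n → U)
    (h : Structure.RelMap (L := mixLang L1 L2) (Sum.inl (Sum.inr r)) v) (i : Fin n) :
    mixR L1 L2 (v i) := by
  have := (mixMem_closure hU (Set.finite_range v)).2.2.1 r
    (fun k => ⟨v k, mem_closure_mixLang ⟨k, rfl⟩⟩) h i
  rwa [← mixR_map_iff L1 L2 (Substructure.subtype _)] at this

theorem mixAdj_sides (hU : IsFraisseLimit (mixClass L1 L2 E1 E2) U) {x y : U}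
    (h : mixAdj L1 L2 x y) :
    (mixL L1 L2 x ∧ mixR L1 L2 y) ∨ (mixR L1 L2 x ∧ mixL L1 L2 y) := by
  let S := Substructure.closure (mixLang L1 L2) {x, y}
  let x' : S := ⟨x, mem_closure_mixLang (by simp)⟩
  let y' : S := ⟨y, mem_closure_mixLang (by simp)⟩
  have := (mixMem_closure hU (Set.toFinite {x, y})).2.2.2.2.1 x' y'
    ((mixAdj_map_iff L1 L2 S.subtype x' y').1 h)
  rwa [← mixL_map_iff L1 L2 S.subtype, ← mixR_map_iff L1 L2 S.subtype,
    ← mixL_map_iff L1 L2 S.subtype, ← mixR_map_iff L1 L2 S.subtype] at this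

theorem isFraisseLimit_mixLeft (hE1 : IsFraisse E1) (hE2 : IsFraisse E2)
    (hE1fin : ∀ M ∈ E1, Finite M) (hE2fin : ∀ M ∈ E2, Finite M)
    (hU : IsFraisseLimit (mixClass L1 L2 E1 E2) U) :
    IsFraisseLimit E1 {x : U // mixL L1 L2 x} where
  ultrahomogeneous := by
    have hnot : ∀ x : {x : U // mixL L1 L2 x}, ¬ mixR L1 L2 (x : U) := fun x h =>
      (mixL_or_mixR hU x).2 ⟨x.2, h⟩
    refine hU.ultrahomogeneous.subtype _ (fun r => Sum.inl (Sum.inl r)) (fun _ _ => Iff.rfl)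
      (fun g x => mixL_map_iff L1 L2 g.toEmbedding x) ?_
    rintro n ((r | r) | r)
    · exact Or.inl ⟨r, rfl⟩
    · refine Or.inr fun v w => ?_
      cases n with
      | zero => rw [Subsingleton.elim v w]
      | succ n =>
        exact iff_of_false (fun h => hnot _ (mixR_of_relMap hU r _ h 0))
          (fun h => hnot _ (mixR_of_relMap hU r _ h 0))
    · refine Or.inr ?_
      match n, r with
      | 1, true =>
        have key (v : Fin 1 → {x : U // mixL L1 L2 x}) :
            (fun i => (v i : U)) = ![(v 0 : U)] := by ext k; fin_cases k; rfl
        intro v w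
        rw [key v, key w]
        exact iff_of_true (v 0).2 (w 0).2
      | 1, false =>
        have key (v : Fin 1 → {x : U // mixL L1 L2 x}) :
            (fun i => (v i : U)) = ![(v 0 : U)] := by ext k; fin_cases k; rfl
        intro v w
        rw [key v, key w]
        exact iff_of_false (hnot (v 0)) (hnot (w 0))
      | 2, () =>
        have key (v : Fin 2 → {x : U // mixL L1 L2 x}) :
            (fun i => (v i : U)) = ![(v 0 : U), (v 1 : U)] := by ext k; fin_cases k <;> rfl
        have hadj (x y : {x : U // mixL L1 L2 x}) : ¬ mixAdj L1 L2 (x : U) y := fun h =>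
          (mixAdj_sides hU h).elim (fun h => hnot y h.2) (fun h => hnot x h.1)
        intro v w
        rw [key v, key w]
        exact iff_of_false (hadj _ _) (hadj _ _)
  age := by
    ext M
    refine ⟨?_, fun hM => ?_⟩
    · rintro ⟨hfg, ⟨e⟩⟩
      have : Finite M := hfg.finite
      let S := Substructure.closure (mixLang L1 L2) (Set.range fun m => (e m : U))
      have hS := (mixMem_closure hU (Set.finite_range fun m => (e m : U))).2.2.2.2.2.1
      let c : M → S := fun m => ⟨e m, mem_closure_mixLang ⟨m, rfl⟩⟩
      let e' : M ↪[L1] {x : S // mixL L1 L2 x} :=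
        { toFun := fun m => ⟨c m, (mixL_map_iff L1 L2 S.subtype (c m)).1 (e m).2⟩
          inj' := fun a b h => e.injective
            (Subtype.ext (congrArg (fun z : {x : S // mixL L1 L2 x} => (z.1 : U)) h))
          map_fun' := fun r => isEmptyElim r
          map_rel' := fun r v => e.map_rel r v }
      exact hE1.hereditary _ hS ⟨hfg, ⟨e'⟩⟩
    · obtain ⟨B, hB⟩ := hE2.is_nonempty
      have := hE1fin M hM
      have := hE2fin B hB
      have h := mixSum_mem_mixClass hE1 hE2 hM hB (fun _ _ => False)
      rw [← hU.age] at h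
      obtain ⟨-, ⟨f⟩⟩ := h
      obtain ⟨g⟩ := mixSum_left_equiv L1 L2 (fun (_ : M) (_ : B) => False)
      exact ⟨hE1.FG M hM, ⟨(mixLeftMap L1 L2 f).comp g.toEmbedding⟩⟩

theorem isFraisseLimit_mixRight (hE1 : IsFraisse E1) (hE2 : IsFraisse E2)
    (hE1fin : ∀ M ∈ E1, Finite M) (hE2fin : ∀ M ∈ E2, Finite M)
    (hU : IsFraisseLimit (mixClass L1 L2 E1 E2) U) :
    IsFraisseLimit E2 {x : U // mixR L1 L2 x} where
  ultrahomogeneous := by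
    have hnot : ∀ x : {x : U // mixR L1 L2 x}, ¬ mixL L1 L2 (x : U) := fun x h =>
      (mixL_or_mixR hU x).2 ⟨h, x.2⟩
    refine hU.ultrahomogeneous.subtype _ (fun r => Sum.inl (Sum.inr r)) (fun _ _ => Iff.rfl)
      (fun g x => mixR_map_iff L1 L2 g.toEmbedding x) ?_
    rintro n ((r | r) | r)
    · refine Or.inr fun v w => ?_
      cases n with
      | zero => rw [Subsingleton.elim v w]
      | succ n =>
        exact iff_of_false (fun h => hnot _ (mixL_of_relMap hU r _ h 0))
          (fun h => hnot _ (mixL_of_relMap hU r _ h 0))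
    · exact Or.inl ⟨r, rfl⟩
    · refine Or.inr ?_
      match n, r with
      | 1, false =>
        have key (v : Fin 1 → {x : U // mixR L1 L2 x}) :
            (fun i => (v i : U)) = ![(v 0 : U)] := by ext k; fin_cases k; rfl
        intro v w
        rw [key v, key w]
        exact iff_of_true (v 0).2 (w 0).2
      | 1, true =>
        have key (v : Fin 1 → {x : U // mixR L1 L2 x}) :
            (fun i => (v i : U)) = ![(v 0 : U)] := by ext k; fin_cases k; rfl
        intro v w
        rw [key v, key w]
        exact iff_of_false (hnot (v 0)) (hnot (w 0))
      | 2, () =>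
        have key (v : Fin 2 → {x : U // mixR L1 L2 x}) :
            (fun i => (v i : U)) = ![(v 0 : U), (v 1 : U)] := by ext k; fin_cases k <;> rfl
        have hadj (x y : {x : U // mixR L1 L2 x}) : ¬ mixAdj L1 L2 (x : U) y := fun h =>
          (mixAdj_sides hU h).elim (fun h => hnot x h.1) (fun h => hnot y h.2)
        intro v w
        rw [key v, key w]
        exact iff_of_false (hadj _ _) (hadj _ _)
  age := by
    ext M
    refine ⟨?_, fun hM => ?_⟩
    · rintro ⟨hfg, ⟨e⟩⟩
      have : Finite M := hfg.finite
      let S := Substructure.closure (mixLang L1 L2) (Set.range fun m => (e m : U))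
      have hS := (mixMem_closure hU (Set.finite_range fun m => (e m : U))).2.2.2.2.2.2
      let c : M → S := fun m => ⟨e m, mem_closure_mixLang ⟨m, rfl⟩⟩
      let e' : M ↪[L2] {x : S // mixR L1 L2 x} :=
        { toFun := fun m => ⟨c m, (mixR_map_iff L1 L2 S.subtype (c m)).1 (e m).2⟩
          inj' := fun a b h => e.injective
            (Subtype.ext (congrArg (fun z : {x : S // mixR L1 L2 x} => (z.1 : U)) h))
          map_fun' := fun r => isEmptyElim r
          map_rel' := fun r v => e.map_rel r v }
      exact hE2.hereditary _ hS ⟨hfg, ⟨e'⟩⟩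
    · obtain ⟨B, hB⟩ := hE1.is_nonempty
      have := hE2fin M hM
      have := hE1fin B hB
      have h := mixSum_mem_mixClass hE1 hE2 hB hM (fun _ _ => False)
      rw [← hU.age] at h
      obtain ⟨-, ⟨f⟩⟩ := h
      obtain ⟨g⟩ := mixSum_right_equiv L1 L2 (fun (_ : B) (_ : M) => False)
      exact ⟨hE2.FG M hM, ⟨(mixRightMap L1 L2 f).comp g.toEmbedding⟩⟩

theorem mixStar_of_isFraisseLimit (hE1 : IsFraisse E1) (hE2 : IsFraisse E2)
    (hE1fin : ∀ M ∈ E1, Finite M) (hE2fin : ∀ M ∈ E2, Finite M)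
    (hdisj1 : DisjointAmalgamation E1) (hdisj2 : DisjointAmalgamation E2)
    (hne1 : ∃ M ∈ E1, Nonempty M) (hne2 : ∃ M ∈ E2, Nonempty M)
    (hU : IsFraisseLimit (mixClass L1 L2 E1 E2) U) : MixStar L1 L2 U := by
  intro A B hAB
  let S := Substructure.closure (mixLang L1 L2) ((A : Set U) ∪ B)
  have hfin : ((A : Set U) ∪ B).Finite := A.finite_toSet.union B.finite_toSet
  have hSfg : S.FG := Substructure.fg_closure hfin
  have hS : MixMem L1 L2 E1 E2 S := mixMem_closure hU hfin
  obtain ⟨Q1, i, hQ1, q1, hq1⟩ := hdisj1.exists_fresh hE1 hne1 _ hS.2.2.2.2.2.1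
  obtain ⟨Q2, j, hQ2, q2, hq2⟩ := hdisj2.exists_fresh hE2 hne2 _ hS.2.2.2.2.2.2
  let E : Q1 → Q2 → Prop := fun a b =>
    (∃ x y, a = i x ∧ b = j y ∧ mixAdj L1 L2 (x : S) (y : S)) ∨
    (a = q1 ∧ ∃ y, b = j y ∧ ((y : S) : U) ∈ A) ∨ (b = q2 ∧ ∃ x, a = i x ∧ ((x : S) : U) ∈ A)
  have hEij : ∀ x y, E (i x) (j y) ↔ mixAdj L1 L2 (x : S) (y : S) := by
    intro x y
    constructor
    · rintro (⟨x', y', hx, hy, h⟩ | ⟨h, -⟩ | ⟨h, -⟩)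
      · rwa [i.injective hx, j.injective hy]
      · exact absurd h (hq1 x)
      · exact absurd h (hq2 y)
    · exact fun h => Or.inl ⟨x, y, rfl, rfl, h⟩
  have hEq1 : ∀ y, E q1 (j y) ↔ ((y : S) : U) ∈ A := by
    intro y
    constructor
    · rintro (⟨x', y', hx, -, -⟩ | ⟨-, y', hy, h⟩ | ⟨h, -⟩)
      · exact absurd hx.symm (hq1 x')
      · rwa [j.injective hy]
      · exact absurd h (hq2 y)
    · exact fun h => Or.inr (Or.inl ⟨rfl, y, rfl, h⟩)
  have hEq2 : ∀ x, E (i x) q2 ↔ ((x : S) : U) ∈ A := by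
    intro x
    constructor
    · rintro (⟨x', y', -, hy, -⟩ | ⟨h, -⟩ | ⟨-, x', hx, h⟩)
      · exact absurd hy.symm (hq2 y')
      · exact absurd h (hq1 x)
      · rwa [i.injective hx]
    · exact fun h => Or.inr (Or.inr ⟨rfl, x, rfl, h⟩)
  obtain ⟨f, hfl, hfr⟩ := hS.exists_embedding_mixSum i j E hEij
  have := hE1fin Q1 hQ1
  have := hE2fin Q2 hQ2
  have h := mixSum_mem_mixClass hE1 hE2 hQ1 hQ2 E
  rw [← hU.age] at h
  have := h.2
  obtain ⟨g, hg⟩ := hU.ultrahomogeneous.extend_embedding (T := MixSum E)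
    ((Substructure.fg_iff_structure_fg S).1 hSfg) S.subtype f
  have hgf : ∀ s : S, g (f s) = s := fun s => (DFunLike.congr_fun hg s).symm
  have hmem : ∀ {x : U}, x ∈ A ∨ x ∈ B → x ∈ S := fun h => mem_closure_mixLang h
  have hl : ∀ s : S, f s ≠ Sum.inl q1 := by
    intro s hs
    obtain h | h := (hS.1 s).1
    · exact hq1 ⟨s, h⟩ (Sum.inl_injective ((hfl ⟨s, h⟩).symm.trans hs))
    · exact Sum.inr_ne_inl ((hfr ⟨s, h⟩).symm.trans hs)
  have hr : ∀ s : S, f s ≠ Sum.inr q2 := by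
    intro s hs
    obtain h | h := (hS.1 s).1
    · exact Sum.inl_ne_inr ((hfl ⟨s, h⟩).symm.trans hs)
    · exact hq2 ⟨s, h⟩ (Sum.inr_injective ((hfr ⟨s, h⟩).symm.trans hs))
  have hlS : g (Sum.inl q1) ∉ S := fun h => hl ⟨_, h⟩ (g.injective (hgf ⟨_, h⟩))
  have hrS : g (Sum.inr q2) ∉ S := fun h => hr ⟨_, h⟩ (g.injective (hgf ⟨_, h⟩))
  have hadjl : ∀ y ∈ S, mixR L1 L2 y → (mixAdj L1 L2 (g (Sum.inl q1)) y ↔ y ∈ A) := by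
    intro y hy hyR
    have hyR' : mixR L1 L2 (⟨y, hy⟩ : S) := (mixR_map_iff L1 L2 S.subtype ⟨y, hy⟩).1 hyR
    have hgy : g (Sum.inr (j ⟨⟨y, hy⟩, hyR'⟩)) = y := by rw [← hfr, hgf]
    rw [← hEq1 ⟨⟨y, hy⟩, hyR'⟩]
    nth_rw 1 [← hgy]
    refine (mixAdj_map_iff L1 L2 g _ _).trans ((mixSum_mixAdj_iff L1 L2 E _ _).trans ?_)
    constructor
    · rintro ⟨a, b, h, ⟨ha, hb⟩ | ⟨hb, -⟩⟩
      · rwa [Sum.inl_injective ha, Sum.inr_injective hb]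
      · exact absurd hb Sum.inl_ne_inr
    · exact fun h => ⟨_, _, h, Or.inl ⟨rfl, rfl⟩⟩
  have hadjr : ∀ x ∈ S, mixL L1 L2 x → (mixAdj L1 L2 x (g (Sum.inr q2)) ↔ x ∈ A) := by
    intro x hx hxL
    have hxL' : mixL L1 L2 (⟨x, hx⟩ : S) := (mixL_map_iff L1 L2 S.subtype ⟨x, hx⟩).1 hxL
    have hgx : g (Sum.inl (i ⟨⟨x, hx⟩, hxL'⟩)) = x := by rw [← hfl, hgf]
    rw [← hEq2 ⟨⟨x, hx⟩, hxL'⟩]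
    nth_rw 1 [← hgx]
    refine (mixAdj_map_iff L1 L2 g _ _).trans ((mixSum_mixAdj_iff L1 L2 E _ _).trans ?_)
    constructor
    · rintro ⟨a, b, h, ⟨ha, hb⟩ | ⟨hb, -⟩⟩
      · rwa [Sum.inl_injective ha, Sum.inr_injective hb]
      · exact absurd hb Sum.inl_ne_inr
    · exact fun h => ⟨_, _, h, Or.inl ⟨rfl, rfl⟩⟩
  have hBA : ∀ {x : U}, x ∈ B → x ∉ A := fun hB hA => Finset.disjoint_left.1 hAB hA hB
  exact ⟨g (Sum.inl q1), g (Sum.inr q2),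
    (mixL_map_iff L1 L2 g (Sum.inl q1)).2 ⟨q1, rfl⟩, (mixR_map_iff L1 L2 g (Sum.inr q2)).2 ⟨q2, rfl⟩,
    fun h => hlS (hmem (Or.inl h)), fun h => hlS (hmem (Or.inr h)),
    fun h => hrS (hmem (Or.inl h)), fun h => hrS (hmem (Or.inr h)),
    fun y hy hyR => (hadjl y (hmem (Or.inl hy)) hyR).2 hy,
    fun y hy hyR h => hBA hy ((hadjl y (hmem (Or.inr hy)) hyR).1 h),
    fun x hx hxL => (hadjr x (hmem (Or.inl hx)) hxL).2 hx,
    fun x hx hxL h => hBA hx ((hadjr x (hmem (Or.inr hx)) hxL).1 h)⟩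

end MixClass

/-- For nondegenerate Fraïssé classes `E1`, `E2` with disjoint amalgamation, in the Fraïssé
limit `U` of `E1 ⋈ E2` the left side is isomorphic to the Fraïssé limit of `E1`, the right
side is isomorphic to the Fraïssé limit of `E2`, and the underlying bipartite graph is the
universal homogeneous bipartite graph, i.e. it satisfies condition `(⋆)`. -/
theorem statement12 (L1 L2 : FirstOrder.Language.{0, 0}) [L1.IsRelational] [L2.IsRelational]
    (E1 : Set (Bundled.{0} L1.Structure)) (E2 : Set (Bundled.{0} L2.Structure))
    (hE1 : FirstOrder.Language.IsFraisse E1) (hE2 : FirstOrder.Language.IsFraisse E2)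
    (hE1fin : ∀ M ∈ E1, Finite M) (hE2fin : ∀ M ∈ E2, Finite M)
    (hdisj1 : DisjointAmalgamation E1) (hdisj2 : DisjointAmalgamation E2)
    (hne1 : ∃ M ∈ E1, Nonempty M) (hne2 : ∃ M ∈ E2, Nonempty M) :
    ∀ (U1 : Type) [L1.Structure U1] [Countable U1],
      FirstOrder.Language.IsFraisseLimit E1 U1 →
    ∀ (U2 : Type) [L2.Structure U2] [Countable U2],
      FirstOrder.Language.IsFraisseLimit E2 U2 →
    ∀ (U : Type) [(mixLang L1 L2).Structure U] [Countable U],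
      FirstOrder.Language.IsFraisseLimit (mixClass L1 L2 E1 E2) U →
      Nonempty (@FirstOrder.Language.Equiv L1 {x : U // mixL L1 L2 x} U1
        (mixLeftStruct L1 L2 U) _) ∧
      Nonempty (@FirstOrder.Language.Equiv L2 {x : U // mixR L1 L2 x} U2
        (mixRightStruct L1 L2 U) _) ∧
      MixStar L1 L2 U := by
  intro U1 _ _ hU1 U2 _ _ hU2 U _ _ hU
  exact ⟨(isFraisseLimit_mixLeft hE1 hE2 hE1fin hE2fin hU).nonempty_equiv hU1,
    (isFraisseLimit_mixRight hE1 hE2 hE1fin hE2fin hU).nonempty_equiv hU2,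
    mixStar_of_isFraisseLimit hE1 hE2 hE1fin hE2fin hdisj1 hdisj2 hne1 hne2 hU⟩
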